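/- (Continuity with respect to two-sided cuts) Let f be an extended real variable with E_V(f) < +∞. For reals A ≤ B define the gamble f_{(A,B)} by truncating f below at A and above at B. Then lim_{A → −∞} lim_{B → +∞} E_V(f_{(A,B)}) = E_V(f). -/

import Mathlib

open Filter

/-- prefix of length `n` of a path -/
def pref {X : Type*} (ω : ℕ → X) (n : ℕ) : List X := (List.range n).map ω

/-- process difference -/
def pdiff {X : Type*} (M : List X → ℝ) (s : List X) : X → ℝ := fun x => M (s ++ [x]) - M s

/-- process multiplier -/
noncomputable def pmul {X : Type*} (M : List X → ℝ) (s : List X) : X → ℝ :=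
  fun x => M (s ++ [x]) / M s

/-- family of coherent upper expectations (local models of an imprecise probability tree) -/
def Coherent {X : Type*} (Q : List X → (X → ℝ) → ℝ) : Prop :=
  ∀ s : List X,
    (∀ h : X → ℝ, Q s h ≤ ⨆ x, h x) ∧
    (∀ h g : X → ℝ, Q s (h + g) ≤ Q s h + Q s g) ∧
    (∀ (h : X → ℝ) (c : ℝ), 0 ≤ c → Q s (c • h) = c * Q s h)

/-- supermartingale for the tree with local models `Q` -/
def IsSupermart {X : Type*} (Q : List X → (X → ℝ) → ℝ) (M : List X → ℝ) : Prop :=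
  ∀ s : List X, Q s (pdiff M s) ≤ 0

/-- bounded below process -/
def BddBelowProc {X : Type*} (M : List X → ℝ) : Prop := ∃ C : ℝ, ∀ s : List X, C ≤ M s

/-- test supermartingale: nonnegative supermartingale with initial value 1 -/
def IsTestSupermart {X : Type*} (Q : List X → (X → ℝ) → ℝ) (M : List X → ℝ) : Prop :=
  IsSupermart Q M ∧ (∀ s : List X, 0 ≤ M s) ∧ M [] = 1

/-- game-theoretic upper expectation conditional on a situation `s` -/
noncomputable def EV {X : Type*} (Q : List X → (X → ℝ) → ℝ) (f : (ℕ → X) → EReal)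
    (s : List X) : EReal :=
  sInf { y : EReal | ∃ M : List X → ℝ, IsSupermart Q M ∧ BddBelowProc M ∧
    (∀ ω : ℕ → X, pref ω s.length = s →
      f ω ≤ Filter.liminf (fun n => ((M (pref ω n) : ℝ) : EReal)) Filter.atTop) ∧
    y = ((M s : ℝ) : EReal) }

section helpers

set_option linter.unusedSectionVars false

variable {X : Type*}

lemma pref_succ (ω : ℕ → X) (n : ℕ) : pref ω (n+1) = pref ω n ++ [ω n] := by
  simp [pref, List.range_succ]

lemma pref_length (ω : ℕ → X) (n : ℕ) : (pref ω n).length = n := by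
  simp [pref]

lemma pref_zero (ω : ℕ → X) : pref ω 0 = [] := by
  simp [pref]

lemma pref_pre_mono (ω : ℕ → X) {k m : ℕ} (h : k ≤ m) : pref ω k <+: pref ω m := by
  induction m, h using Nat.le_induction with
  | base => exact List.prefix_rfl
  | succ m _ ih => rw [pref_succ]; exact ih.trans (List.prefix_append _ _)

lemma pref_of_pre_list (ω : ℕ → X) {u v : List X} (h : u <+: v)
    (hv : pref ω v.length = v) : pref ω u.length = u := by
  have h1 : pref ω u.length <+: v := by
    have := pref_pre_mono ω h.length_le
    rwa [hv] at this
  exact (List.prefix_of_prefix_length_le h1 h (by rw [pref_length])).eq_of_length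
    (by rw [pref_length])

lemma exists_rec {σ : Type*} (s0 : σ) (step : List X → X → σ → σ) :
    ∃ S : List X → σ, S [] = s0 ∧ ∀ s x, S (s ++ [x]) = step s x (S s) := by
  refine ⟨fun l => List.reverseRecOn (motive := fun _ => σ) l s0 (fun s x r => step s x r), ?_, ?_⟩
  · simp
  · intro s x
    simp

variable [Fintype X] [Nonempty X] {Q : List X → (X → ℝ) → ℝ}

lemma Q_le (hQ : Coherent Q) (s : List X) {h g : X → ℝ} {c : ℝ}
    (hle : ∀ x, h x ≤ g x + c) : Q s h ≤ Q s g + c := by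
  have h1 := (hQ s).2.1 g (h - g)
  have h2 := (hQ s).1 (h - g)
  have h3 : (⨆ x, (h - g) x) ≤ c := ciSup_le (fun x => by
    have := hle x
    simp only [Pi.sub_apply]; linarith)
  have h4 : g + (h - g) = h := by ext x; simp
  rw [h4] at h1
  linarith

lemma Q_zero (hQ : Coherent Q) (s : List X) : Q s 0 = 0 := by
  have := (hQ s).2.2 0 0 le_rfl
  simpa using this

lemma exists_down (hQ : Coherent Q) {N : List X → ℝ} (hN : IsSupermart Q N) (s : List X) :
    ∃ x, N (s ++ [x]) ≤ N s := by
  by_contra! hc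
  obtain ⟨x0, hx0⟩ := Finite.exists_min (fun x => N (s ++ [x]))
  have h1 : Q s 0 ≤ Q s (pdiff N s) + (-(N (s ++ [x0]) - N s)) := by
    apply Q_le hQ
    intro x
    have := hx0 x
    simp only [pdiff, Pi.zero_apply]; linarith
  rw [Q_zero hQ] at h1
  have := hN s
  have := hc x0
  linarith

lemma lower (hQ : Coherent Q) {N : List X → ℝ} (hN : IsSupermart Q N) (s : List X) (A : ℝ)
    (h : ∀ ω : ℕ → X, pref ω s.length = s →
      (A : EReal) ≤ liminf (fun n => ((N (pref ω n) : ℝ) : EReal)) atTop) : A ≤ N s := by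
  choose d hd using exists_down hQ hN
  let g : List X → X := fun l => if hl : l.length < s.length then s[l.length] else d l
  let u : ℕ → List X := fun k => Nat.rec [] (fun _ l => l ++ [g l]) k
  have hu : ∀ k, u (k+1) = u k ++ [g (u k)] := fun k => rfl
  let ω : ℕ → X := fun k => g (u k)
  have hp : ∀ k, pref ω k = u k := by
    intro k
    induction k with
    | zero => rw [pref_zero]; rfl
    | succ k ih => rw [pref_succ, ih, hu]
  have ht : ∀ k, k ≤ s.length → u k = s.take k := by
    intro k
    induction k with
    | zero => intro _; simp [u]
    | succ k ih =>
      intro hk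
      have hl : (u k).length = k := by rw [← hp, pref_length]
      have hlt : (u k).length < s.length := by omega
      rw [hu, ← List.take_concat_get' s k (by omega), ← ih (by omega)]
      have hk' : k < s.length := by omega
      simp [g, hl, hk']
  have hs : u s.length = s := by rw [ht _ le_rfl]; simp
  have hanti : ∀ k, s.length ≤ k → N (u k) ≤ N s := by
    intro k hk
    induction k, hk using Nat.le_induction with
    | base => rw [hs]
    | succ k hk ih =>
      have hl : (u k).length = k := by rw [← hp, pref_length]
      rw [hu]
      have : g (u k) = d (u k) := by simp [g, hl, not_lt.mpr hk]
      rw [this]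
      exact (hd _).trans ih
  have h1 := h ω (by rw [hp, hs])
  have h2 : liminf (fun n => ((N (pref ω n) : ℝ) : EReal)) atTop ≤ (N s : EReal) := by
    apply liminf_le_of_frequently_le'
    apply Eventually.frequently
    filter_upwards [eventually_ge_atTop s.length] with k hk
    rw [hp]
    exact_mod_cast hanti k hk
  exact_mod_cast h1.trans h2

lemma supermart_min (hQ : Coherent Q) {N : List X → ℝ} (hN : IsSupermart Q N) (b : ℝ) :
    IsSupermart Q (fun s => min (N s) b) := by
  intro s
  rcases le_total (N s) b with h | h
  · have := Q_le hQ s (h := pdiff (fun s => min (N s) b) s) (g := pdiff N s) (c := 0) (by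
      intro x
      simp only [pdiff, min_eq_left h]
      have := min_le_left (N (s ++ [x])) b
      linarith)
    have := hN s
    linarith
  · have := Q_le hQ s (h := pdiff (fun s => min (N s) b) s) (g := 0) (c := 0) (by
      intro x
      simp only [pdiff, min_eq_right h, Pi.zero_apply]
      have := min_le_right (N (s ++ [x])) b
      linarith)
    rw [Q_zero hQ] at this
    linarith

lemma upcross (hQ : Coherent Q) (V : List X → ℝ) {A a b : ℝ} (hA : A < a) (hab : a < b)
    (G : (ℕ → X) → Prop)
    (hbuy : ∀ u, V u < a → ∃ N : List X → ℝ, IsSupermart Q N ∧ N u < a ∧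
      (∀ v, u <+: v → A ≤ N v ∧ N v ≤ b) ∧
      ∀ ω, G ω → pref ω u.length = u → ∀ᶠ k in atTop, b ≤ N (pref ω k)) :
    ∃ T : List X → ℝ, IsSupermart Q T ∧ (∀ s, 0 ≤ T s) ∧ T [] = a - A ∧
      (∀ s x, T (s ++ [x]) ≤ T s + (b - A)) ∧
      ∀ ω, G ω → (∃ᶠ k in atTop, V (pref ω k) < a) →
        Tendsto (fun k => T (pref ω k)) atTop atTop := by
  classical
  choose! N hNs hNa hNb hNG using hbuy
  obtain ⟨S, hS0, hS⟩ := exists_rec (X := X) (σ := Option (List X)) none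
    (fun s x o => match o with
      | some u => if b ≤ N u (s ++ [x]) then none else some u
      | none => if V (s ++ [x]) < a then some (s ++ [x]) else none)
  obtain ⟨T, hT0, hT⟩ := exists_rec (X := X) (σ := ℝ) (a - A)
    (fun s x t => match S s with
      | some u => t + (N u (s ++ [x]) - N u s)
      | none => t)

  have inv : ∀ s u, S s = some u → u <+: s ∧ V u < a := by
    intro s
    induction s using List.reverseRecOn with
    | nil => intro u hu; simp [hS0] at hu
    | append_singleton s x ih =>
      intro u hu
      rw [hS] at hu
      cases hs : S s with
      | none =>
        simp only [hs] at hu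
        split_ifs at hu with h
        cases hu
        exact ⟨List.prefix_rfl, h⟩
      | some v =>
        simp only [hs] at hu
        split_ifs at hu with h
        cases hu
        exact ⟨(ih _ hs).1.trans (List.prefix_append _ _), (ih _ hs).2⟩
  let P : List X → ℝ := fun s => match S s with
      | some u => T s - (N u s - a)
      | none => T s
  have hPmono : ∀ s x, P s ≤ P (s ++ [x]) := by
    intro s x
    cases hs : S s with
    | none =>
      have h1 := hT s x
      have h2 := hS s x
      simp only [hs] at h1 h2
      split_ifs at h2 with h
      · simp only [P, hs, h2, h1]
        have := hNa _ h
        linarith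
      · simp only [P, hs, h2, h1]; exact le_rfl
    | some u =>
      have h1 := hT s x
      have h2 := hS s x
      simp only [hs] at h1 h2
      split_ifs at h2 with h
      · simp only [P, hs, h2, h1]
        linarith
      · simp only [P, hs, h2, h1]; linarith
  have hPjump : ∀ s x u, S s = some u → b ≤ N u (s ++ [x]) → P s + (b - a) ≤ P (s ++ [x]) := by
    intro s x u hs h
    have h1 := hT s x
    have h2 := hS s x
    simp only [hs] at h1 h2
    rw [if_pos h] at h2
    simp only [P, hs, h2, h1]
    linarith
  have hP0 : ∀ s, a - A ≤ P s := by
    intro s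
    induction s using List.reverseRecOn with
    | nil => simp only [P, hS0, hT0]; exact le_rfl
    | append_singleton s x ih => exact ih.trans (hPmono s x)
  have hTP : ∀ s, P s - (a - A) ≤ T s := by
    intro s
    cases hs : S s with
    | none => simp only [P, hs]; linarith
    | some u =>
      have := ((hNb u (inv s u hs).2) s (inv s u hs).1).1
      simp only [P, hs]; linarith
  refine ⟨T, ?_, ?_, hT0, ?_, ?_⟩
  · intro s
    cases hs : S s with
    | none =>
      have : pdiff T s = 0 := by
        ext x
        have h1 := hT s x
        simp only [hs] at h1
        simp [pdiff, h1]
      rw [this, Q_zero hQ]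
    | some u =>
      have : pdiff T s = pdiff (N u) s := by
        ext x
        have h1 := hT s x
        simp only [hs] at h1
        simp [pdiff, h1]
      rw [this]
      exact hNs u (inv s u hs).2 s
  · intro s
    have := hP0 s
    have := hTP s
    linarith
  · intro s x
    have h1 := hT s x
    cases hs : S s with
    | none => simp only [hs] at h1; linarith
    | some u =>
      simp only [hs] at h1
      obtain ⟨hp, hv⟩ := inv s u hs
      have h2 := (hNb u hv s hp).1
      have h3 := (hNb u hv (s ++ [x]) (hp.trans (List.prefix_append _ _))).2
      linarith
  · intro ω hG hfreq
    have hmono : Monotone (fun k => P (pref ω k)) :=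
      monotone_nat_of_le_succ (fun k => by rw [pref_succ]; exact hPmono _ _)
    have key : ∀ k, ∃ j, P (pref ω k) + (b - a) ≤ P (pref ω j) := by
      intro k
      by_contra! hc
      have hno : ∀ j, k ≤ j → ∀ u, S (pref ω j) = some u → N u (pref ω (j+1)) < b := by
        intro j hj u hu
        by_contra! hb
        have h1 := hPjump (pref ω j) (ω j) u hu (by rwa [← pref_succ])
        rw [← pref_succ] at h1
        have h2 : P (pref ω k) ≤ P (pref ω j) := hmono hj
        have h3 := hc (j+1)
        linarith
      have hsome : ∃ j, k ≤ j ∧ ∃ u, S (pref ω j) = some u := by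
        by_contra! hn
        have hnone : ∀ j, k ≤ j → S (pref ω j) = none := by
          intro j hj
          exact Option.eq_none_iff_forall_ne_some.mpr (hn j hj)
        obtain ⟨j, hj, hVj⟩ := (frequently_atTop.mp hfreq) (k+1)
        obtain ⟨i, rfl⟩ : ∃ i, j = i + 1 := ⟨j-1, by omega⟩
        have h1 := hnone (i+1) (by omega)
        rw [pref_succ] at h1 hVj
        rw [hS, hnone i (by omega)] at h1
        simp [hVj] at h1
      obtain ⟨j, hj, u, hu⟩ := hsome
      have hall : ∀ i, j ≤ i → S (pref ω i) = some u := by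
        intro i hi
        induction i, hi using Nat.le_induction with
        | base => exact hu
        | succ i hi ih =>
          have := hno i (hj.trans hi) u ih
          rw [pref_succ] at this ⊢
          rw [hS, ih]
          simp [this]
      obtain ⟨hp, hv⟩ := inv _ _ hu
      have hpu : pref ω u.length = u := pref_of_pre_list ω hp (by rw [pref_length])
      obtain ⟨i, hi⟩ := ((hNG u hv ω hG hpu).and (eventually_ge_atTop (j+1))).exists
      obtain ⟨hi1, hi2⟩ := hi
      obtain ⟨i, rfl⟩ : ∃ i', i = i' + 1 := ⟨i-1, by omega⟩
      have := hno i (by omega) u (hall i (by omega))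
      linarith
    have hn : ∀ n : ℕ, ∃ j, n * (b - a) ≤ P (pref ω j) := by
      intro n
      induction n with
      | zero =>
        refine ⟨0, ?_⟩
        have := hP0 (pref ω 0)
        push_cast
        linarith
      | succ n ih =>
        obtain ⟨j, hj⟩ := ih
        obtain ⟨i, hi⟩ := key j
        refine ⟨i, ?_⟩
        push_cast
        linarith
    have hPt : Tendsto (fun k => P (pref ω k)) atTop atTop := by
      apply tendsto_atTop_atTop_of_monotone hmono
      intro c
      obtain ⟨n, hn'⟩ := exists_nat_ge (c / (b - a))
      obtain ⟨j, hj⟩ := hn n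
      refine ⟨j, le_trans ?_ hj⟩
      rwa [div_le_iff₀ (by linarith)] at hn'
    exact tendsto_atTop_mono (fun k => hTP _) (tendsto_atTop_add_const_right _ (-(a - A)) hPt)

lemma supermart_tsum (hQ : Coherent Q) {ι : Type*} (w : ι → ℝ) (hw : ∀ i, 0 ≤ w i)
    (T : ι → List X → ℝ) (hT : ∀ i, IsSupermart Q (T i))
    (hsum : ∀ s, Summable (fun i => w i * T i s)) :
    IsSupermart Q (fun s => ∑' i, w i * T i s) := by
  classical
  intro s
  have hfin : ∀ F : Finset ι, Q s (fun x => ∑ i ∈ F, w i * pdiff (T i) s x) ≤ 0 := by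
    intro F
    induction F using Finset.induction_on with
    | empty => exact (Q_zero hQ s).le
    | insert i F hi ih =>
      have h1 : (fun x => ∑ j ∈ insert i F, w j * pdiff (T j) s x) =
          (w i • pdiff (T i) s) + (fun x => ∑ i ∈ F, w i * pdiff (T i) s x) := by
        ext x
        simp [Finset.sum_insert hi]
      rw [h1]
      have h2 := (hQ s).2.1 (w i • pdiff (T i) s) (fun x => ∑ i ∈ F, w i * pdiff (T i) s x)
      rw [(hQ s).2.2 _ _ (hw i)] at h2
      have h3 := mul_nonpos_of_nonneg_of_nonpos (hw i) (hT i s)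
      linarith
  apply le_of_forall_pos_le_add
  intro η hη
  have hs : ∀ x, HasSum (fun i => w i * pdiff (T i) s x)
      (pdiff (fun s => ∑' i, w i * T i s) s x) := by
    intro x
    have := (hsum (s ++ [x])).hasSum.sub (hsum s).hasSum
    simpa [pdiff, mul_sub] using this
  have hev : ∀ᶠ F in (atTop : Filter (Finset ι)), ∀ x,
      pdiff (fun s => ∑' i, w i * T i s) s x - η < ∑ i ∈ F, w i * pdiff (T i) s x := by
    rw [eventually_all]
    intro x
    exact (hs x).eventually_const_lt (by linarith)
  obtain ⟨F, hF⟩ := hev.exists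
  have h1 := Q_le hQ s (h := pdiff (fun s => ∑' i, w i * T i s) s)
    (g := fun x => ∑ i ∈ F, w i * pdiff (T i) s x) (c := η) (fun x => by
      have := hF x
      linarith)
  have := hfin F
  linarith

lemma EV_mono {f g : (ℕ → X) → EReal} (h : ∀ ω, f ω ≤ g ω) (s : List X) :
    EV Q f s ≤ EV Q g s := by
  apply sInf_le_sInf
  rintro y ⟨M, h1, h2, h3, h4⟩
  exact ⟨M, h1, h2, fun ω hω => (h ω).trans (h3 ω hω), h4⟩

/-- continuity from below for upper cuts of a variable bounded below -/
lemma main_step (hQ : Coherent Q) (g : (ℕ → X) → EReal) (A : ℝ) (hA : ∀ ω, (A : EReal) ≤ g ω)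
    (M0 : List X → ℝ) (hM0 : IsSupermart Q M0) (hM0b : BddBelowProc M0)
    (hM0g : ∀ ω, g ω ≤ liminf (fun n => ((M0 (pref ω n) : ℝ) : EReal)) atTop) :
    EV Q g [] ≤ ⨆ B : ℝ, EV Q (fun ω => min (g ω) (B : EReal)) [] := by
  classical
  let n0 : ℕ := ⌈A⌉₊
  let c : ℕ → ℝ := fun n => ((n0 + n : ℕ) : ℝ)
  have hcA : ∀ n, A ≤ c n := fun n => (Nat.le_ceil A).trans (by
    simp only [c]; exact_mod_cast Nat.le_add_right _ _)
  have hcmono : Monotone c := by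
    intro m n h
    simp only [c]; exact_mod_cast Nat.add_le_add_left h _
  let W : ℕ → List X → EReal := fun n s => EV Q (fun ω => min (g ω) (c n : EReal)) s
  have hWmono : ∀ s, Monotone (fun n => W n s) := by
    intro s m n h
    exact EV_mono (fun ω => min_le_min le_rfl (by exact_mod_cast hcmono h)) s

  have hcand : ∀ n u (N : List X → ℝ), IsSupermart Q N → (∀ ω : ℕ → X, pref ω u.length = u →
      min (g ω) (c n : EReal) ≤ liminf (fun n => ((N (pref ω n) : ℝ) : EReal)) atTop) →
      ∀ v, u <+: v → A ≤ N v := by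
    intro n u N hN hl v huv
    apply lower hQ hN
    intro ω hω
    refine le_trans ?_ (hl ω (pref_of_pre_list ω huv hω))
    exact le_min (hA ω) (by exact_mod_cast hcA n)
  have hWA : ∀ n s, (A : EReal) ≤ W n s := by
    intro n s
    apply le_sInf
    rintro y ⟨N, h1, h2, h3, rfl⟩
    exact_mod_cast hcand n s N h1 h3 s List.prefix_rfl
  have hWM : ∀ n s, W n s ≤ (M0 s : EReal) := by
    intro n s
    apply sInf_le
    exact ⟨M0, hM0, hM0b, fun ω _ => (min_le_left _ _).trans (hM0g ω), rfl⟩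
  let V : List X → ℝ := fun s => (⨆ n, W n s).toReal
  have hV : ∀ s, (V s : EReal) = ⨆ n, W n s := by
    intro s
    apply EReal.coe_toReal
    · exact ne_top_of_le_ne_top (EReal.coe_ne_top (M0 s)) (iSup_le (fun n => hWM n s))
    · exact ne_bot_of_le_ne_bot (EReal.coe_ne_bot A) ((hWA 0 s).trans (le_iSup (fun n => W n s) 0))
  have hWV : ∀ n s, W n s ≤ (V s : EReal) := fun n s => by
    rw [hV]; exact le_iSup (fun n => W n s) n
  have hVA : ∀ s, A ≤ V s := fun s => by exact_mod_cast (hWA 0 s).trans (hWV 0 s)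
  have hget : ∀ n s (a : ℝ), V s < a → ∃ N : List X → ℝ, IsSupermart Q N ∧ BddBelowProc N ∧
      (∀ ω : ℕ → X, pref ω s.length = s →
      min (g ω) (c n : EReal) ≤ liminf (fun n => ((N (pref ω n) : ℝ) : EReal)) atTop) ∧
      N s < a := by
    intro n s a ha
    have h1 : W n s < (a : EReal) := (hWV n s).trans_lt (by exact_mod_cast ha)
    obtain ⟨y, ⟨N, h1, h2, h3, rfl⟩, hy⟩ := sInf_lt_iff.mp h1
    exact ⟨N, h1, h2, h3, by exact_mod_cast hy⟩
  have hVs : IsSupermart Q V := by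
    intro s
    apply le_of_forall_pos_le_add
    intro η hη
    have h1 : ∀ᶠ n in atTop, ∀ x, ((V (s ++ [x]) - η / 2 : ℝ) : EReal) < W n (s ++ [x]) := by
      rw [eventually_all]
      intro x
      have ht := tendsto_atTop_iSup (hWmono (s ++ [x]))
      rw [← hV] at ht
      exact ht.eventually_const_lt (by exact_mod_cast (by linarith))
    obtain ⟨n, hn⟩ := h1.exists
    obtain ⟨N, hN1, hN2, hN3, hN4⟩ := hget n s (V s + η / 2) (by linarith)
    have h2 : ∀ x, V (s ++ [x]) - η / 2 < N (s ++ [x]) := by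
      intro x
      have h3 : W n (s ++ [x]) ≤ (N (s ++ [x]) : EReal) := by
        apply sInf_le
        exact ⟨N, hN1, hN2, fun ω hω => hN3 ω
          (pref_of_pre_list ω (List.prefix_append _ _) hω), rfl⟩
      exact_mod_cast (hn x).trans_le h3
    have h3 := Q_le hQ s (h := pdiff V s) (g := pdiff N s) (c := η) (fun x => by
      have := h2 x
      simp only [pdiff]; linarith)
    have := hN1 s
    linarith
  let ι := {p : ℚ × ℚ // A < (p.1 : ℝ) ∧ (p.1 : ℝ) < (p.2 : ℝ)}
  have hup : ∀ p : ι, ∃ T : List X → ℝ, IsSupermart Q T ∧ (∀ s, 0 ≤ T s) ∧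
      T [] = (p.1.1 : ℝ) - A ∧
      (∀ s x, T (s ++ [x]) ≤ T s + ((p.1.2 : ℝ) - A)) ∧
      ∀ ω, ((p.1.2 : ℝ) : EReal) < g ω → (∃ᶠ k in atTop, V (pref ω k) < (p.1.1 : ℝ)) →
        Tendsto (fun k => T (pref ω k)) atTop atTop := by
    rintro ⟨⟨a, b⟩, h1, h2⟩
    simp only at h1 h2 ⊢
    refine upcross hQ V h1 h2 (fun ω => ((b : ℝ) : EReal) < g ω) ?_
    intro u hu
    obtain ⟨n, hn⟩ := exists_nat_gt (b : ℝ)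
    have hcn : (b : ℝ) < c n := hn.trans_le (by
      simp only [c]; exact_mod_cast Nat.le_add_left _ _)
    obtain ⟨N, hN1, hN2, hN3, hN4⟩ := hget n u a hu
    refine ⟨fun s => min (N s) b, supermart_min hQ hN1 _, (min_le_left _ _).trans_lt hN4, ?_, ?_⟩
    · intro v hv
      exact ⟨le_min (hcand n u N hN1 hN3 v hv) (by linarith), min_le_right _ _⟩
    · intro ω hω hωu
      have h3 : ((b : ℝ) : EReal) < liminf (fun n => ((N (pref ω n) : ℝ) : EReal)) atTop :=
        (lt_min hω (by exact_mod_cast hcn)).trans_le (hN3 ω hωu)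
      filter_upwards [eventually_lt_of_lt_liminf h3] with k hk
      exact le_min (by exact_mod_cast hk.le) le_rfl
  choose T hTs hT0 hTi hTd hTt using hup
  have hVsup : (V [] : EReal) ≤ ⨆ B : ℝ, EV Q (fun ω => min (g ω) (B : EReal)) [] := by
    rw [hV]
    exact iSup_le fun n => le_iSup (fun B : ℝ => EV Q (fun ω => min (g ω) (B : EReal)) []) (c n)
  refine le_trans ?_ hVsup
  apply EReal.le_of_forall_lt_iff_le.mp
  intro z hz
  have hz' : V [] < z := by exact_mod_cast hz
  have : Encodable ι := Encodable.ofCountable ι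
  obtain ⟨e, he, S, hS, hSz⟩ := posSumOfEncodable (sub_pos.mpr hz') ι
  let K : ι → ℝ := fun p => (p.1.2 : ℝ) - A
  have hK : ∀ p, 0 < K p := fun p => by
    have h1 := p.2.1
    have h2 := p.2.2
    simp only [K]; linarith
  let w : ι → ℝ := fun p => e p / K p
  have hw : ∀ p, 0 < w p := fun p => div_pos (he p) (hK p)
  have hTK : ∀ p s, T p s ≤ K p * (s.length + 1) := by
    intro p s
    induction s using List.reverseRecOn with
    | nil =>
      have := p.2.2
      rw [hTi]; simp [K]; exact_mod_cast this.le
    | append_singleton s x ih =>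
      refine (hTd p s x).trans ?_
      simp only [List.length_append, List.length_singleton]
      push_cast
      have : (p.1.2 : ℝ) - A = K p := rfl
      rw [this]
      linarith
  have hwT : ∀ p s, w p * T p s ≤ e p * (s.length + 1) := by
    intro p s
    have h1 := mul_le_mul_of_nonneg_left (hTK p s) (hw p).le
    have h2 : w p * (K p * (s.length + 1)) = e p * (s.length + 1) := by
      rw [← mul_assoc, div_mul_cancel₀ _ (hK p).ne']
    linarith
  have hnn : ∀ s p, 0 ≤ w p * T p s := fun s p => mul_nonneg (hw p).le (hT0 p s)
  have hsum : ∀ s, Summable (fun p => w p * T p s) := fun s =>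
    Summable.of_nonneg_of_le (hnn s) (fun p => hwT p s) (hS.summable.mul_right _)
  have hR := supermart_tsum hQ w (fun p => (hw p).le) T hTs hsum
  have hR0 : ∀ s, 0 ≤ ∑' p, w p * T p s := fun s => tsum_nonneg (hnn s)
  have hRz : ∑' p, w p * T p [] ≤ z - V [] := by
    refine le_trans ?_ hSz
    rw [← hS.tsum_eq]
    refine (hsum []).tsum_le_tsum (fun p => ?_) hS.summable
    simpa using hwT p []
  have hEV : EV Q g [] ≤ ((V [] + ∑' p, w p * T p [] : ℝ) : EReal) := by
    apply sInf_le
    refine ⟨fun s => V s + ∑' p, w p * T p s, ?_, ⟨A, fun s => ?_⟩, ?_, rfl⟩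
    · intro s
      have h1 : pdiff (fun s => V s + ∑' p, w p * T p s) s =
          pdiff V s + pdiff (fun s => ∑' p, w p * T p s) s := by
        ext x; simp only [pdiff, Pi.add_apply]; ring
      rw [h1]
      have h2 := (hQ s).2.1 (pdiff V s) (pdiff (fun s => ∑' p, w p * T p s) s)
      have h3 := hVs s
      have h4 := hR s
      linarith
    · have h1 := hVA s
      have h2 := hR0 s
      linarith
    · intro ω _
      by_cases hcase : g ω ≤ liminf (fun n => ((V (pref ω n) : ℝ) : EReal)) atTop
      · refine hcase.trans (liminf_le_liminf ?_)
        filter_upwards with k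
        have : V (pref ω k) ≤ V (pref ω k) + ∑' p, w p * T p (pref ω k) := by
          have := hR0 (pref ω k)
          linarith
        exact_mod_cast this
      · rw [not_le] at hcase
        obtain ⟨a, ha1, ha2⟩ := EReal.lt_iff_exists_rat_btwn.mp hcase
        obtain ⟨b, hb1, hb2⟩ := EReal.lt_iff_exists_rat_btwn.mp ha2
        have hfreq : ∃ᶠ k in atTop, V (pref ω k) < (a : ℝ) := by
          refine (frequently_lt_of_liminf_lt (by isBoundedDefault) ha1).mono ?_
          intro k hk
          exact_mod_cast hk
        have hAa : A < (a : ℝ) := by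
          obtain ⟨k, hk⟩ := hfreq.exists
          exact (hVA _).trans_lt hk
        have hab : (a : ℝ) < (b : ℝ) := EReal.coe_lt_coe_iff.mp hb1
        let p : ι := ⟨(a, b), hAa, hab⟩
        have ht := hTt p ω hb2 hfreq
        have ht2 : Tendsto (fun k => V (pref ω k) + ∑' p, w p * T p (pref ω k)) atTop atTop := by
          refine tendsto_atTop_mono (fun k => ?_)
            (tendsto_atTop_add_const_left atTop A (ht.const_mul_atTop (hw p)))
          have h1 := (hsum (pref ω k)).le_tsum p (fun q _ => hnn (pref ω k) q)
          have h2 := hVA (pref ω k)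
          linarith
        have ht3 := (EReal.tendsto_coe_nhds_top_iff.mpr ht2).liminf_eq
        rw [ht3]
        exact le_top
  refine hEV.trans ?_
  have : V [] + ∑' p, w p * T p [] ≤ z := by linarith
  exact_mod_cast this

end helpers

theorem continuity_two_sided_cuts {X : Type*} [Fintype X] [Nonempty X]
    (Q : List X → (X → ℝ) → ℝ) (hQ : Coherent Q)
    (f : (ℕ → X) → EReal) (hfin : EV Q f [] < ⊤) :
    ∃ L : ℝ → EReal,
      (∀ A : ℝ, Filter.Tendsto
          (fun B : ℝ => EV Q (fun ω => min (max (f ω) (A : EReal)) (B : EReal)) [])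
          Filter.atTop (nhds (L A))) ∧
      Filter.Tendsto L Filter.atBot (nhds (EV Q f [])) := by
  obtain ⟨y, ⟨M0, hM0, ⟨C, hC⟩, hM0f, rfl⟩, -⟩ := sInf_lt_iff.mp hfin
  refine ⟨fun A => EV Q (fun ω => max (f ω) (A : EReal)) [], ?_, ?_⟩
  · intro A
    have hmono : Monotone (fun B : ℝ => EV Q (fun ω => min (max (f ω) (A : EReal)) (B : EReal)) []) := by
      intro B B' h
      exact EV_mono (fun ω => min_le_min le_rfl (by exact_mod_cast h)) _
    have ht := tendsto_atTop_iSup hmono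
    convert ht using 2
    apply le_antisymm
    · set d : ℝ := max (A - C) 0 with hd
      refine main_step hQ (fun ω => max (f ω) (A : EReal)) A (fun ω => le_max_right _ _)
        (fun s => M0 s + d) ?_ ⟨C + d, fun s => by have := hC s; linarith⟩ ?_
      · intro s
        have : pdiff (fun s => M0 s + d) s = pdiff M0 s := by
          ext x; simp [pdiff]
        rw [this]; exact hM0 s
      · intro ω
        apply max_le
        · refine (hM0f ω (by simp [pref])).trans ?_
          refine liminf_le_liminf ?_
          filter_upwards with k
          have : M0 (pref ω k) ≤ M0 (pref ω k) + d := by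
            have := le_max_right (A - C) 0
            linarith
          exact_mod_cast this
        · refine le_liminf_of_le (by isBoundedDefault) ?_
          filter_upwards with k
          have : A ≤ M0 (pref ω k) + d := by
            have := le_max_left (A - C) 0
            have := hC (pref ω k)
            linarith
          exact_mod_cast this
    · exact iSup_le fun B => EV_mono (fun ω => min_le_left _ _) _
  · have hmono : Monotone (fun A : ℝ => EV Q (fun ω => max (f ω) (A : EReal)) []) := by
      intro B B' h
      exact EV_mono (fun ω => max_le_max le_rfl (by exact_mod_cast h)) _
    have ht := tendsto_atBot_iInf hmono
    convert ht using 2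
    apply le_antisymm
    · exact le_iInf fun A => EV_mono (fun ω => le_max_left _ _) _
    · apply le_sInf
      rintro y ⟨M, hM, ⟨D, hD⟩, hMf, rfl⟩
      refine (iInf_le _ D).trans ?_
      apply sInf_le
      refine ⟨M, hM, ⟨D, hD⟩, fun ω hω => max_le (hMf ω hω) ?_, rfl⟩
      refine le_liminf_of_le (by isBoundedDefault) ?_
      filter_upwards with k
      exact_mod_cast hD _
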